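/- Let p(z) = (z − 1)² and assume q is not a root of unity and α₀, α₋, α₊ are nonzero. Then for all k ∈ ℕ the integral satisfies, in coker(div): [k+1]·Λ(z^k) = −(k−1)·Λ(1) + [2]·k·Λ(z), where z = z₋z₊ and [l] = (1 − q^{2l})/(1 − q²). -/

import Mathlib

noncomputable section

open Polynomial
open scoped Classical

namespace GWAPaper

variable (K : Type) [Field K]

/-- Defining relations of the generalized Weyl algebra `A(p;q)`; the generators are
indexed by `Fin 4` with `0 ↦ x₊`, `1 ↦ x₋`, `2 ↦ z₊`, `3 ↦ z₋`. -/
inductive GWARel (q : K) (p : K[X]) :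
    FreeAlgebra K (Fin 4) → FreeAlgebra K (Fin 4) → Prop
  | zz : GWARel q p (FreeAlgebra.ι K (2 : Fin 4) * FreeAlgebra.ι K (3 : Fin 4))
      (FreeAlgebra.ι K (3 : Fin 4) * FreeAlgebra.ι K (2 : Fin 4))
  | xpzp : GWARel q p (FreeAlgebra.ι K (0 : Fin 4) * FreeAlgebra.ι K (2 : Fin 4))
      (q⁻¹ • (FreeAlgebra.ι K (2 : Fin 4) * FreeAlgebra.ι K (0 : Fin 4)))
  | xpzm : GWARel q p (FreeAlgebra.ι K (0 : Fin 4) * FreeAlgebra.ι K (3 : Fin 4))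
      (q⁻¹ • (FreeAlgebra.ι K (3 : Fin 4) * FreeAlgebra.ι K (0 : Fin 4)))
  | xmzp : GWARel q p (FreeAlgebra.ι K (1 : Fin 4) * FreeAlgebra.ι K (2 : Fin 4))
      (q • (FreeAlgebra.ι K (2 : Fin 4) * FreeAlgebra.ι K (1 : Fin 4)))
  | xmzm : GWARel q p (FreeAlgebra.ι K (1 : Fin 4) * FreeAlgebra.ι K (3 : Fin 4))
      (q • (FreeAlgebra.ι K (3 : Fin 4) * FreeAlgebra.ι K (1 : Fin 4)))
  | xpxm : GWARel q p (FreeAlgebra.ι K (0 : Fin 4) * FreeAlgebra.ι K (1 : Fin 4))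
      (Polynomial.aeval (FreeAlgebra.ι K (2 : Fin 4) * FreeAlgebra.ι K (3 : Fin 4)) p)
  | xmxp : GWARel q p (FreeAlgebra.ι K (1 : Fin 4) * FreeAlgebra.ι K (0 : Fin 4))
      (Polynomial.aeval ((q ^ 2 : K) • (FreeAlgebra.ι K (3 : Fin 4) * FreeAlgebra.ι K (2 : Fin 4))) p)

/-- The generalized Weyl algebra `A(p;q)`. -/
abbrev GWA (q : K) (p : K[X]) : Type := RingQuot (GWARel K q p)

/-- The images of the four generators in `A(p;q)`. -/
def gwaGen (q : K) (p : K[X]) (i : Fin 4) : GWA K q p :=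
  RingQuot.mkAlgHom K (GWARel K q p) (FreeAlgebra.ι K i)

/-- The generator `x₊`. -/
def xp (q : K) (p : K[X]) : GWA K q p := gwaGen K q p 0
/-- The generator `x₋`. -/
def xm (q : K) (p : K[X]) : GWA K q p := gwaGen K q p 1
/-- The generator `z₊`. -/
def zp (q : K) (p : K[X]) : GWA K q p := gwaGen K q p 2
/-- The generator `z₋`. -/
def zm (q : K) (p : K[X]) : GWA K q p := gwaGen K q p 3

/-- ℤ-degrees of the generators: `deg x₊ = deg z₊ = 1`, `deg x₋ = deg z₋ = -1`. -/
def gwaWt : Fin 4 → ℤ := ![1, -1, 1, -1]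

/-- The total degree of a word in the generators. -/
def wordDeg (w : List (Fin 4)) : ℤ := (w.map gwaWt).sum

/-- The product in `A(p;q)` of the letters of a word. -/
def wordVal (q : K) (p : K[X]) (w : List (Fin 4)) : GWA K q p :=
  (w.map (gwaGen K q p)).prod

/-- The degree-`n` homogeneous component of the ℤ-graded algebra `A(p;q)`:
the `K`-linear span of the values of all words of total degree `n`. -/
def component (q : K) (p : K[X]) (n : ℤ) : Submodule K (GWA K q p) :=
  Submodule.span K {a | ∃ w : List (Fin 4), wordDeg w = n ∧ wordVal K q p w = a}

/-- The `q²`-derivative `p_{q²}` of a polynomial `p`, equal to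
`(p(q²z) - p(z))/((q²-1)z)` if `q² ≠ 1` and to `p'` if `q² = 1`. -/
def qDeriv (q : K) (p : K[X]) : K[X] :=
  if q ^ 2 = 1 then derivative p
  else (p.comp (C (q ^ 2) * X) - p) / (C (q ^ 2 - 1) * X)

/-- The polynomial `c(z) = q·p_{q²}(z)`. -/
def cPoly (q : K) (p : K[X]) : K[X] := C q * qDeriv K q p

/-- `p` is `q²`-separable: `p(z)` is coprime with `z·p_{q²}(z)`. -/
def QSeparable (q : K) (p : K[X]) : Prop := IsCoprime p (X * qDeriv K q p)

/-- The right `A(p;q)`-action on the free left module `Ω = A(p;q)³` with basis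
`ω₋, ω₀, ω₊` (coordinates `0, 1, 2`), twisted by the automorphisms `σ₋ = σ₊` and `σ₀`:
`ω₋·a = σ₋(a)·ω₋`, `ω₀·a = σ₀(a)·ω₀`, `ω₊·a = σ₊(a)·ω₊`. -/
def rAct (q : K) (p : K[X]) (σm σ0 : GWA K q p ≃ₐ[K] GWA K q p)
    (ω : Fin 3 → GWA K q p) (a : GWA K q p) : Fin 3 → GWA K q p :=
  ![ω 0 * σm a, ω 1 * σ0 a, ω 2 * σm a]

/-- A right `A(p;q)`-module map `Ω → A(p;q)`, where `Ω` is the free left module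
with basis `ω₋, ω₀, ω₊` and right action `rAct`. -/
structure OmegaRightHom (q : K) (p : K[X]) (σm σ0 : GWA K q p ≃ₐ[K] GWA K q p) : Type where
  toFun : (Fin 3 → GWA K q p) → GWA K q p
  map_add' : ∀ ω η, toFun (ω + η) = toFun ω + toFun η
  map_rmul' : ∀ ω a, toFun (rAct K q p σm σ0 ω a) = toFun ω * a

/-- The divergence associated with the calculus `(Ω, d)`:
`div(ξ) = q⁻²·∂₋(ξ(ω₋)) + ∂₀(ξ(ω₀)) + q²·∂₊(ξ(ω₊))`. -/
def divMap (q : K) (p : K[X]) (σm σ0 : GWA K q p ≃ₐ[K] GWA K q p)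
    (D0 Dm Dp : GWA K q p →ₗ[K] GWA K q p) (ξ : OmegaRightHom K q p σm σ0) : GWA K q p :=
  q ^ (-2 : ℤ) • Dm (ξ.toFun ![1, 0, 0]) + D0 (ξ.toFun ![0, 1, 0]) + q ^ 2 • Dp (ξ.toFun ![0, 0, 1])

/-- The image of the divergence, as a `K`-subspace of `A(p;q)`. -/
def imDiv (q : K) (p : K[X]) (σm σ0 : GWA K q p ≃ₐ[K] GWA K q p)
    (D0 Dm Dp : GWA K q p →ₗ[K] GWA K q p) : Submodule K (GWA K q p) :=
  Submodule.span K (Set.range (divMap K q p σm σ0 D0 Dm Dp))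
section GenericComputation

variable {K}
variable {A : Type*} [Ring A] [Algebra K A]

/-- Moving a power of `w` through an element that commutes with `w` up to a scalar. -/
theorem mul_pow_of_mul_eq_smul_mul {x w : A} {c : K} (h : x * w = c • (w * x)) (n : ℕ) :
    x * w ^ n = c ^ n • (w ^ n * x) := by
  induction n with
  | zero => simp
  | succ n ih =>
    rw [pow_succ, ← mul_assoc, ih, smul_mul_assoc, mul_assoc, h, mul_smul_comm, smul_smul,
      ← mul_assoc, pow_succ]

/-- The value of a skew derivation `D` of the type of `∂₋` on `x₋ z₋ (z₋ z₊) ^ n`, when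
`p = (z - 1) ^ 2`. -/
theorem skewDerivation_xm_zm_pow {q α : K} (hq : q ≠ 0) {x y u v : A}
    (hvu : v * u = u * v)
    (hyv : y * v = q • (v * y)) (hyu : y * u = q • (u * y))
    (hyx : y * x = (q ^ 2 • (u * v) - 1) ^ 2)
    {σ : A ≃ₐ[K] A} (hσu : σ u = q⁻¹ • u) (hσv : σ v = q • v)
    {D : A →ₗ[K] A} (hD : ∀ a b, D (a * b) = D a * σ b + a * D b)
    (hDy : D y = α • (q • ((q ^ 2 + 1) • (v * u) - 2) * v)) (hDu : D u = α • x) (hDv : D v = 0)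
    (n : ℕ) :
    D (y * u * (u * v) ^ n) =
      α • ((∑ i ∈ Finset.range (n + 3), (q ^ 2) ^ i) • (u * v) ^ (n + 2)
        - (2 * ∑ i ∈ Finset.range (n + 2), (q ^ 2) ^ i) • (u * v) ^ (n + 1)
        + (∑ i ∈ Finset.range (n + 1), (q ^ 2) ^ i) • (u * v) ^ n) := by
  have hsq : y * x = q ^ 4 • (u * v) ^ 2 - (2 * q ^ 2) • (u * v) + 1 := by
    rw [hyx, sq, sub_mul, mul_sub, smul_mul_smul_comm, mul_one, one_mul, sq (u * v)]
    module
  induction n with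
  | zero =>
    have hDyσ : D y * σ u = α • ((q ^ 2 + 1) • (u * v) ^ 2 - (2 : K) • (u * v)) := by
      have h2 : (2 : A) * (v * u) = (2 : K) • (v * u) := by rw [two_mul, two_smul]
      rw [hDy, hσu, mul_smul_comm, smul_mul_assoc, smul_mul_assoc, smul_mul_assoc, mul_assoc,
        sub_mul, smul_mul_assoc, h2, hvu, ← sq]
      match_scalars <;> field_simp
    rw [pow_zero, mul_one, hD, hDyσ, hDu, mul_smul_comm, hsq]
    simp only [Finset.sum_range_succ, Finset.sum_range_zero, pow_zero, zero_add, pow_one]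
    module
  | succ n ih =>
    have hσ : σ (u * v) = u * v := by
      rw [map_mul, hσu, hσv, smul_mul_smul_comm, inv_mul_cancel₀ hq, one_smul]
    have hDuv : D (u * v) = α • (v * x) := by
      rw [← hvu, hD, hDv, hDu, zero_mul, zero_add, mul_smul_comm]
    have hy : y * (u * v) = q ^ 2 • (u * v * y) := by
      rw [← mul_assoc, hyu, smul_mul_assoc, mul_assoc, hyv, mul_smul_comm, smul_smul, ← sq,
        mul_assoc]
    have hmove : y * u * (u * v) ^ n * (v * x) =
        (q ^ 2) ^ (n + 1) • ((u * v) ^ (n + 1) * (y * x)) := by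
      have hcomm : u * (u * v) ^ n * v = (u * v) ^ (n + 1) := by
        have : Commute u (u * v) := by
          rw [Commute, SemiconjBy, mul_assoc, ← hvu, ← mul_assoc, ← hvu]
        rw [(this.pow_right n).eq, mul_assoc, pow_succ]
      calc y * u * (u * v) ^ n * (v * x) = y * (u * (u * v) ^ n * v) * x := by
            simp only [mul_assoc]
        _ = _ := by
            rw [hcomm, mul_pow_of_mul_eq_smul_mul hy, smul_mul_assoc, mul_assoc]
    rw [pow_succ, ← mul_assoc, hD, ih, hσ, hDuv, mul_smul_comm, hmove, hsq, smul_mul_assoc,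
      add_mul, sub_mul, smul_mul_assoc, smul_mul_assoc, smul_mul_assoc, ← pow_succ, ← pow_succ,
      ← pow_succ, mul_add, mul_sub, mul_smul_comm, mul_smul_comm, ← pow_add, ← pow_succ, mul_one]
    simp only [Finset.sum_range_succ _ (n + 1), Finset.sum_range_succ _ (n + 1 + 1),
      Finset.sum_range_succ _ (n + 1 + 2)]
    module

/-- A sequence with vanishing second differences is an arithmetic progression. -/
theorem eq_of_second_difference_eq_zero {M : Type*} [AddCommGroup M] [Module K M] {a : ℕ → M}
    (h : ∀ n, a (n + 2) - (2 : K) • a (n + 1) + a n = 0) (n : ℕ) :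
    a n = (-((n : K) - 1)) • a 0 + (n : K) • a 1 := by
  induction n using Nat.twoStepInduction with
  | zero => simp
  | one => simp
  | more n h₀ h₁ =>
    have : a (n + 2) = (2 : K) • a (n + 1) - a n := by
      rw [← sub_eq_zero, ← h n]; abel
    rw [this, h₀, h₁]
    push_cast
    module

end GenericComputation

theorem gwaGen_mem_component (q : K) (p : K[X]) (i : Fin 4) :
    gwaGen K q p i ∈ component K q p (gwaWt i) :=
  Submodule.subset_span ⟨[i], by simp [wordDeg], by simp [wordVal]⟩

theorem zp_mul_zm (q : K) (p : K[X]) : zp K q p * zm K q p = zm K q p * zp K q p := by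
  simpa only [map_mul, zp, zm, gwaGen] using RingQuot.mkAlgHom_rel K (GWARel.zz (q := q) (p := p))

theorem xm_mul_zp (q : K) (p : K[X]) : xm K q p * zp K q p = q • (zp K q p * xm K q p) := by
  simpa only [map_mul, map_smul, xm, zp, zm, gwaGen] using
    RingQuot.mkAlgHom_rel K (GWARel.xmzp (q := q) (p := p))

theorem xm_mul_zm (q : K) (p : K[X]) : xm K q p * zm K q p = q • (zm K q p * xm K q p) := by
  simpa only [map_mul, map_smul, xm, zp, zm, gwaGen] using
    RingQuot.mkAlgHom_rel K (GWARel.xmzm (q := q) (p := p))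

theorem xm_mul_xp (q : K) (p : K[X]) :
    xm K q p * xp K q p = aeval (q ^ 2 • (zm K q p * zp K q p)) p := by
  have h := RingQuot.mkAlgHom_rel K (GWARel.xmxp (q := q) (p := p))
  rw [← Polynomial.aeval_algHom_apply] at h
  simpa only [map_mul, map_smul, xm, xp, zp, zm, gwaGen] using h

/-- The `q²`-derivative of `(z - 1) ^ 2`. -/
theorem qDeriv_X_sub_one_sq {q : K} (hq : q ^ 2 ≠ 1) :
    qDeriv K q ((X - 1) ^ 2) = C (q ^ 2 + 1) * X - 2 := by
  have hne : (C (q ^ 2 - 1) * X : K[X]) ≠ 0 :=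
    mul_ne_zero (C_ne_zero.mpr (sub_ne_zero.mpr hq)) X_ne_zero
  have h : ((X - 1) ^ 2 : K[X]).comp (C (q ^ 2) * X) - (X - 1) ^ 2
      = C (q ^ 2 - 1) * X * (C (q ^ 2 + 1) * X - 2) := by
    simp only [pow_comp, sub_comp, X_comp, one_comp, C_sub, C_add, C_1]
    ring
  rw [qDeriv, if_neg hq, h, mul_div_cancel_left₀ _ hne]

/-- The values of `∂₋` lie in the image of the divergence. -/
theorem Dm_mem_imDiv {q : K} (hq : q ≠ 0) (p : K[X]) (σm σ0 : GWA K q p ≃ₐ[K] GWA K q p)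
    (D0 Dm Dp : GWA K q p →ₗ[K] GWA K q p) (a : GWA K q p) :
    Dm a ∈ imDiv K q p σm σ0 D0 Dm Dp := by
  let ξ : OmegaRightHom K q p σm σ0 :=
    { toFun := fun ω => a * σm.symm (ω 0)
      map_add' := fun ω η => by simp [mul_add]
      map_rmul' := fun ω b => by simp [rAct, mul_assoc] }
  have h : divMap K q p σm σ0 D0 Dm Dp ξ = q ^ (-2 : ℤ) • Dm a := by
    simp [divMap, ξ]
  have hmem : divMap K q p σm σ0 D0 Dm Dp ξ ∈ imDiv K q p σm σ0 D0 Dm Dp :=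
    Submodule.subset_span ⟨ξ, rfl⟩
  rw [h] at hmem
  exact (Submodule.smul_mem_iff _ (zpow_ne_zero _ hq)).mp hmem

/-- For `p(z) = (z − 1)²` and `q` not a root of unity the integral
satisfies `[k+1]·Λ(z^k) = −(k−1)·Λ(1) + [2]·k·Λ(z)` for all `k ∈ ℕ`. -/
theorem integral_example_two [CharZero K]
    (q : K) (hq : q ≠ 0) (p : K[X])
    (hp : p = (X - 1) ^ 2)
    (α0 αm αp : K)
    (σm : GWA K q p ≃ₐ[K] GWA K q p)
    (hσm : ∀ (n : ℤ) (a : GWA K q p), a ∈ component K q p n → σm a = q ^ n • a)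
    (σ0 : GWA K q p ≃ₐ[K] GWA K q p)
    (hσ0 : ∀ (n : ℤ) (a : GWA K q p), a ∈ component K q p n → σ0 a = q ^ (2 * n) • a)
    (D0 Dm Dp : GWA K q p →ₗ[K] GWA K q p)
    (hD0leib : ∀ a b, D0 (a * b) = D0 a * σ0 b + a * D0 b)
    (hD0xp : D0 (xp K q p) = α0 • xp K q p)
    (hD0xm : D0 (xm K q p) = -(q ^ (-2 : ℤ) * α0) • xm K q p)
    (hD0zp : D0 (zp K q p) = α0 • zp K q p)
    (hD0zm : D0 (zm K q p) = -(q ^ (-2 : ℤ) * α0) • zm K q p)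
    (hDmleib : ∀ a b, Dm (a * b) = Dm a * σm b + a * Dm b)
    (hDmxp : Dm (xp K q p) = 0)
    (hDmzp : Dm (zp K q p) = 0)
    (hDmxm : Dm (xm K q p) = αm • (aeval (zp K q p * zm K q p) (cPoly K q p) * zp K q p))
    (hDmzm : Dm (zm K q p) = αm • xp K q p)
    (hDpleib : ∀ a b, Dp (a * b) = Dp a * σm b + a * Dp b)
    (hDpxm : Dp (xm K q p) = 0)
    (hDpzm : Dp (zm K q p) = 0)
    (hDpxp : Dp (xp K q p) = αp • (aeval (zp K q p * zm K q p) (cPoly K q p) * zm K q p))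
    (hDpzp : Dp (zp K q p) = αp • xm K q p)
    (hqru : ∀ n : ℕ, q ^ n = 1 → n = 0)
    (hα0 : α0 ≠ 0) (hαm : αm ≠ 0) (hαp : αp ≠ 0) :
    ∀ k : ℕ,
      ((1 - q ^ (2 * (k + 1))) / (1 - q ^ 2)) •
          (imDiv K q p σm σ0 D0 Dm Dp).mkQ ((zm K q p * zp K q p) ^ k)
        = (-((k : K) - 1)) • (imDiv K q p σm σ0 D0 Dm Dp).mkQ 1
            + (((1 - q ^ 4) / (1 - q ^ 2)) * (k : K)) •
                (imDiv K q p σm σ0 D0 Dm Dp).mkQ (zm K q p * zp K q p) := by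
  have hq2 : q ^ 2 ≠ 1 := fun h => two_ne_zero (hqru 2 h)
  have hgeom : ∀ n : ℕ, (1 - q ^ (2 * n)) / (1 - q ^ 2) = ∑ i ∈ Finset.range n, (q ^ 2) ^ i := by
    intro n
    rw [geom_sum_eq hq2, ← neg_sub (q ^ (2 * n)), ← neg_sub (q ^ 2), neg_div_neg_eq, pow_mul]
  have hσzm : σm (zm K q p) = q⁻¹ • zm K q p := by
    simpa [gwaWt, zm] using hσm _ _ (gwaGen_mem_component K q p 3)
  have hσzp : σm (zp K q p) = q • zp K q p := by
    simpa [gwaWt, zp] using hσm _ _ (gwaGen_mem_component K q p 2)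
  have hyx : xm K q p * xp K q p = (q ^ 2 • (zm K q p * zp K q p) - 1) ^ 2 := by
    have (a : GWA K q p) : aeval a p = aeval a ((X - 1) ^ 2 : K[X]) :=
      congrArg (fun r : K[X] => aeval a r) hp
    rw [xm_mul_xp, this]
    simp
  have hc : aeval (zp K q p * zm K q p) (cPoly K q p)
      = q • ((q ^ 2 + 1) • (zp K q p * zm K q p) - 2) := by
    have : cPoly K q p = C q * (C (q ^ 2 + 1) * X - 2) := by
      rw [cPoly, hp, qDeriv_X_sub_one_sq K hq2]
    rw [this, ← smul_eq_C_mul, ← smul_eq_C_mul, map_smul, map_sub, map_smul, aeval_X, map_ofNat]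
  rw [hc] at hDmxm
  set Λ := (imDiv K q p σm σ0 D0 Dm Dp).mkQ
  have hrec : ∀ n : ℕ,
      (∑ i ∈ Finset.range (n + 3), (q ^ 2) ^ i) • Λ ((zm K q p * zp K q p) ^ (n + 2))
        - (2 : K) • ((∑ i ∈ Finset.range (n + 2), (q ^ 2) ^ i) •
            Λ ((zm K q p * zp K q p) ^ (n + 1)))
        + (∑ i ∈ Finset.range (n + 1), (q ^ 2) ^ i) • Λ ((zm K q p * zp K q p) ^ n) = 0 := by
    intro n
    have hmem := Dm_mem_imDiv K hq p σm σ0 D0 Dm Dp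
      (xm K q p * zm K q p * (zm K q p * zp K q p) ^ n)
    rw [skewDerivation_xm_zm_pow hq (zp_mul_zm K q p) (xm_mul_zp K q p) (xm_mul_zm K q p) hyx
      hσzm hσzp hDmleib hDmxm hDmzm hDmzp, Submodule.smul_mem_iff _ hαm] at hmem
    rw [← (Submodule.Quotient.mk_eq_zero _).mpr hmem, ← Submodule.mkQ_apply]
    simp only [map_add, map_sub, map_smul, smul_smul]
    rfl
  intro k
  have h := eq_of_second_difference_eq_zero
    (a := fun n => (∑ i ∈ Finset.range (n + 1), (q ^ 2) ^ i) • Λ ((zm K q p * zp K q p) ^ n))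
    hrec k
  have h4 := hgeom 2
  norm_num at h4
  rw [hgeom, h4]
  simpa [smul_smul, mul_comm] using h

end GWAPaper
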